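/- arXiv:1710.08507 — 2 statements merged into one kernel-verified Lean document; each statement's English description precedes it below -/
import Mathlib

section
/- For all nonnegative integers r and n, the number of pairs (λ, π) of partitions, where λ has largest part exactly k and π has all parts at most k+r for some nonnegative integer k, with |λ| + |π| = n, equals the number of pairs (μ, ν) of partitions with |μ| + |ν| = n, where μ is an arbitrary partition and ν has a (k+r+1)×k Durfee rectangle with largest part below the rectangle less than k+r+1, for some nonnegative integer k. -/
/-- A partition is a finite multiset of positive integers. -/
def IsPartition (m : Multiset ℕ) : Prop := ∀ x ∈ m, 0 < x

/-- The largest even part of a partition (0 if there are no even parts). -/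
def lep (m : Multiset ℕ) : ℕ := (m.filter (fun x => Even x)).sup

/-- `EO*`: every even part is smaller than every odd part, every part other than the
largest even part appears an even number of times, and the largest even part appears
an odd number of times. -/
def EOStar (m : Multiset ℕ) : Prop :=
  IsPartition m ∧
  (∀ x ∈ m, ∀ y ∈ m, Even x → Odd y → x < y) ∧
  (∀ x ∈ m, x ≠ lep m → Even (m.count x)) ∧
  (∀ x ∈ m, x = lep m → Odd (m.count x))

/-- `E*`: partitions into even parts where each distinct part appears an even number of times. -/
def EStar (m : Multiset ℕ) : Prop :=
  IsPartition m ∧ (∀ x ∈ m, Even x) ∧ ∀ x : ℕ, Even (m.count x)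

/-- `O_k*`: partitions into odd parts with exactly `2k` parts where each distinct part
appears an even number of times. -/
def OStar (k : ℕ) (m : Multiset ℕ) : Prop :=
  IsPartition m ∧ (∀ x ∈ m, Odd x) ∧ Multiset.card m = 2 * k ∧ ∀ x : ℕ, Even (m.count x)

/-- `Q_{k,r}`: partitions with a `(k+r+1) × k` Durfee rectangle whose largest part below
the rectangle is `< k+r+1`; equivalently, exactly `k` parts are `≥ k+r+1`. -/
def QSet (k r : ℕ) (m : Multiset ℕ) : Prop :=
  IsPartition m ∧ Multiset.card (m.filter (fun x => k + r + 1 ≤ x)) = k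

/-- `EO*_{k,r}`: partitions in `EO*` with exactly `2k` odd parts and largest even part `2k+2r`. -/
def EOkr (k r : ℕ) (m : Multiset ℕ) : Prop :=
  EOStar m ∧ Multiset.card (m.filter (fun x => Odd x)) = 2 * k ∧ lep m = 2 * k + 2 * r

/-- The even-odd crank: largest even part minus the number of odd parts. -/
def eoc (m : Multiset ℕ) : ℤ :=
  (lep m : ℤ) - (Multiset.card (m.filter (fun x => Odd x)) : ℤ)

/-- The conjugate partition: its `i`-th part is the number of parts that are `≥ i`. -/
def conjugate (m : Multiset ℕ) : Multiset ℕ :=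
  (Multiset.range m.sup).map (fun i => Multiset.card (m.filter (fun x => i + 1 ≤ x)))

/-- An overpartition: a partition together with a set of overlined part values, which must
be a subset of the distinct part values. -/
def IsOverpartition (p : Multiset ℕ × Finset ℕ) : Prop :=
  IsPartition p.1 ∧ p.2 ⊆ p.1.toFinset

/-- The multisets of positive integers with a given sum form a finite family. -/
theorem finite_isPartition_sum_le (n : ℕ) :
    {m : Multiset ℕ | IsPartition m ∧ m.sum ≤ n}.Finite := by
  refine (Set.finite_Iic (n • Multiset.range (n + 1))).subset ?_
  rintro m ⟨hm, hs⟩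
  rw [Set.mem_Iic, Multiset.le_iff_count]
  intro x
  by_cases hx : x ∈ m
  · have hxn : x < n + 1 := by
      have := Multiset.single_le_sum (fun y _ => Nat.zero_le y) x hx
      omega
    have hc : m.card ≤ m.sum := by
      have := Multiset.card_nsmul_le_sum (s := m) (a := 1) (fun y hy => hm y hy)
      simpa using this
    have h1 : 1 ≤ (Multiset.range (n + 1)).count x :=
      Multiset.one_le_count_iff_mem.2 (Multiset.mem_range.2 hxn)
    have h2 := Multiset.count_le_card x m
    rw [Multiset.count_nsmul]
    nlinarith
  · simp [Multiset.count_eq_zero_of_notMem hx]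

theorem finite_partition_pairs (n : ℕ) :
    {p : Multiset ℕ × Multiset ℕ |
      (IsPartition p.1 ∧ IsPartition p.2) ∧ p.1.sum + p.2.sum = n}.Finite := by
  refine ((finite_isPartition_sum_le n).prod (finite_isPartition_sum_le n)).subset ?_
  rintro ⟨a, b⟩ ⟨⟨ha, hb⟩, h⟩
  dsimp only at ha hb h
  exact ⟨⟨ha, by dsimp only; omega⟩, ⟨hb, by dsimp only; omega⟩⟩

/-- Two families of subsets whose graded complements satisfy the same shift recursion have
the same number of elements of each size. -/
theorem ncard_eq_of_complement_recursion {α : Type*} (size : α → ℕ) (U : Set α)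
    (hU : ∀ n, {p | p ∈ U ∧ size p = n}.Finite) (F G : ℕ → Set α)
    (hFU : ∀ r, F r ⊆ U) (hGU : ∀ r, G r ⊆ U)
    (hF : ∀ r n, {p | p ∈ F (r + 1) ∧ size p + (r + 1) = n}.ncard =
      {p | (p ∈ U ∧ p ∉ F r) ∧ size p = n}.ncard)
    (hG : ∀ r n, {p | p ∈ G (r + 1) ∧ size p + (r + 1) = n}.ncard =
      {p | (p ∈ U ∧ p ∉ G r) ∧ size p = n}.ncard) (r n : ℕ) :
    {p | p ∈ F r ∧ size p = n}.ncard = {p | p ∈ G r ∧ size p = n}.ncard := by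
  have key : ∀ H : ℕ → Set α, (∀ r, H r ⊆ U) → ∀ r n,
      {p | p ∈ H r ∧ size p = n}.ncard + {p | (p ∈ U ∧ p ∉ H r) ∧ size p = n}.ncard =
        {p | p ∈ U ∧ size p = n}.ncard := by
    intro H hH r n
    rw [← Set.ncard_union_eq ?_ ((hU n).subset fun p hp => ⟨hH r hp.1, hp.2⟩)
      ((hU n).subset fun p hp => ⟨hp.1.1, hp.2⟩)]
    · congr 1
      ext p
      have := @hH r p
      simp only [Set.mem_union, Set.mem_ofPred_eq]
      tauto
    · rw [Set.disjoint_left]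
      rintro p ⟨h, -⟩ ⟨⟨-, h'⟩, -⟩
      exact h' h
  induction n using Nat.strong_induction_on generalizing r with
  | _ n ih =>
    have h1 := key F hFU r n
    have h2 := key G hGU r n
    have h3 : {p | p ∈ F (r + 1) ∧ size p + (r + 1) = n}.ncard =
        {p | p ∈ G (r + 1) ∧ size p + (r + 1) = n}.ncard := by
      by_cases hn : r + 1 ≤ n
      · have := ih (n - (r + 1)) (by omega) (r + 1)
        have e : ∀ p, size p + (r + 1) = n ↔ size p = n - (r + 1) := fun p => by omega
        simpa only [e] using this
      · have e : ∀ p, ¬ size p + (r + 1) = n := fun p => by omega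
        simp [e]
    rw [← hF, h3, hG] at h1
    omega

theorem Multiset.sup_mem_of_ne_zero {m : Multiset ℕ} (h : m ≠ 0) : m.sup ∈ m := by
  induction m using Multiset.induction_on with
  | empty => exact absurd rfl h
  | cons a s ih =>
    rw [Multiset.sup_cons]
    rcases le_total a s.sup with hle | hle
    · rw [sup_eq_right.2 hle]
      by_cases hs : s = 0
      · subst hs
        simp at hle
        simp [hle]
      · exact Multiset.mem_cons_of_mem (ih hs)
    · rw [sup_eq_left.2 hle]
      exact Multiset.mem_cons_self _ _

theorem Multiset.sum_erase_sup_add (m : Multiset ℕ) : (m.erase m.sup).sum + m.sup = m.sum := by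
  by_cases h : m = 0
  · subst h; rfl
  · rw [add_comm, Multiset.sum_erase (Multiset.sup_mem_of_ne_zero h)]

/-- Among partitions, removing the largest part is injective once the largest part is known. -/
theorem IsPartition.eq_of_erase_sup {a b : Multiset ℕ} (ha : IsPartition a) (hb : IsPartition b)
    (hs : a.sup = b.sup) (he : a.erase a.sup = b.erase b.sup) : a = b := by
  have hz : ∀ m : Multiset ℕ, IsPartition m → (m = 0 ↔ m.sup = 0) := by
    refine fun m hm => ⟨fun h => by simp [h], fun h => ?_⟩
    by_contra h0
    have := hm _ (Multiset.sup_mem_of_ne_zero h0)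
    omega
  by_cases h : a = 0
  · rw [h, eq_comm, hz b hb, ← hs, ← hz a ha, h]
  · have h' : b ≠ 0 := by rwa [Ne, hz b hb, ← hs, ← hz a ha]
    rw [← Multiset.cons_erase (Multiset.sup_mem_of_ne_zero h), he, hs,
      Multiset.cons_erase (Multiset.sup_mem_of_ne_zero h')]

theorem ncard_sup_recursion (r n : ℕ) :
    {p : Multiset ℕ × Multiset ℕ |
      ((IsPartition p.1 ∧ IsPartition p.2) ∧ p.2.sup ≤ p.1.sup + (r + 1)) ∧
        p.1.sum + p.2.sum + (r + 1) = n}.ncard =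
    {p : Multiset ℕ × Multiset ℕ | ((IsPartition p.1 ∧ IsPartition p.2) ∧
      ¬ ((IsPartition p.1 ∧ IsPartition p.2) ∧ p.2.sup ≤ p.1.sup + r)) ∧
        p.1.sum + p.2.sum = n}.ncard := by
  refine Set.ncard_congr (fun p _ => (p.1.erase p.1.sup, (p.1.sup + (r + 1)) ::ₘ p.2)) ?_ ?_ ?_
  · rintro ⟨a, b⟩ ⟨⟨⟨ha, hb⟩, h⟩, hs⟩
    dsimp only at ha hb h hs ⊢
    have h1 : IsPartition (a.erase a.sup) := fun x hx => ha x (Multiset.mem_of_mem_erase hx)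
    have h2 : IsPartition ((a.sup + (r + 1)) ::ₘ b) := by
      intro x hx
      rcases Multiset.mem_cons.1 hx with rfl | hx
      · omega
      · exact hb x hx
    refine ⟨⟨⟨h1, h2⟩, fun h3 => ?_⟩, ?_⟩
    · have h4 := h3.2
      have h5 : (a.erase a.sup).sup ≤ a.sup := Multiset.sup_mono (Multiset.erase_subset _ _)
      dsimp only at h4
      rw [Multiset.sup_cons, sup_eq_left.2 h] at h4
      omega
    · have := a.sum_erase_sup_add
      simp only [Multiset.sum_cons]
      omega
  · rintro ⟨a, b⟩ ⟨c, d⟩ ⟨⟨⟨ha, hb⟩, h⟩, hs⟩ ⟨⟨⟨hc, hd⟩, h'⟩, hs'⟩ he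
    dsimp only at ha hb h hs hc hd h' hs' he
    rw [Prod.mk.injEq] at he
    have e := congrArg Multiset.sup he.2
    rw [Multiset.sup_cons, Multiset.sup_cons, sup_eq_left.2 h, sup_eq_left.2 h'] at e
    have e' : a.sup = c.sup := by omega
    have e2 := he.2
    rw [e', Multiset.cons_inj_right] at e2
    rw [ha.eq_of_erase_sup hc e' he.1, e2]
  · rintro ⟨a, b⟩ ⟨⟨⟨ha, hb⟩, h⟩, hs⟩
    dsimp only at ha hb h hs
    have h : a.sup + (r + 1) ≤ b.sup := by
      by_contra h'
      exact h ⟨⟨ha, hb⟩, by omega⟩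
    have hb0 : b ≠ 0 := by
      rintro rfl
      simp at h
    have hbm := Multiset.sup_mem_of_ne_zero hb0
    have hsb := b.sum_erase_sup_add
    have hb' : IsPartition (b.erase b.sup) := fun x hx => hb x (Multiset.mem_of_mem_erase hx)
    have hbs : (b.erase b.sup).sup ≤ b.sup := Multiset.sup_mono (Multiset.erase_subset _ _)
    rcases Nat.eq_or_lt_of_le (show r + 1 ≤ b.sup by omega) with hr | hr
    · have ha0 : a = 0 := by
        by_contra h0
        have := ha _ (Multiset.sup_mem_of_ne_zero h0)
        omega
      subst ha0
      refine ⟨(0, b.erase b.sup), ⟨⟨⟨ha, hb'⟩, ?_⟩, ?_⟩, ?_⟩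
      · simpa [hr] using hbs
      · dsimp only
        omega
      · have : (0 : Multiset ℕ).sup + (r + 1) = b.sup := by simpa using hr
        dsimp only
        rw [this, Multiset.cons_erase hbm]
        simp
    · have hsup : ((b.sup - (r + 1)) ::ₘ a).sup = b.sup - (r + 1) := by
        rw [Multiset.sup_cons, sup_eq_left]
        omega
      refine ⟨((b.sup - (r + 1)) ::ₘ a, b.erase b.sup), ⟨⟨⟨?_, hb'⟩, ?_⟩, ?_⟩, ?_⟩
      · intro x hx
        rcases Multiset.mem_cons.1 hx with rfl | hx
        · omega
        · exact ha x hx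
      · dsimp only
        rw [hsup]
        omega
      · simp only [Multiset.sum_cons]
        omega
      · dsimp only
        rw [hsup, Multiset.erase_cons_head, show b.sup - (r + 1) + (r + 1) = b.sup by omega,
          Multiset.cons_erase hbm]

/-- The number of parts of `m` that are at least `t`. -/
def cardGE (t : ℕ) (m : Multiset ℕ) : ℕ := Multiset.card (m.filter (fun x => t ≤ x))

theorem cardGE_anti (m : Multiset ℕ) {s t : ℕ} (h : s ≤ t) : cardGE t m ≤ cardGE s m :=
  Multiset.card_le_card (Multiset.monotone_filter_right m fun _ hx => h.trans hx)

theorem cardGE_add (t : ℕ) (a b : Multiset ℕ) : cardGE t (a + b) = cardGE t a + cardGE t b := by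
  simp [cardGE]

theorem cardGE_eq_card {t : ℕ} {m : Multiset ℕ} (h : ∀ x ∈ m, t ≤ x) :
    cardGE t m = Multiset.card m := by
  rw [cardGE, Multiset.filter_eq_self.2 h]

theorem cardGE_eq_zero {t : ℕ} {m : Multiset ℕ} (h : ∀ x ∈ m, x < t) : cardGE t m = 0 := by
  rw [cardGE, Multiset.filter_eq_nil.2 fun x hx => by simpa using h x hx, Multiset.card_zero]

theorem cardGE_le_card (t : ℕ) (m : Multiset ℕ) : cardGE t m ≤ Multiset.card m :=
  Multiset.card_le_card (Multiset.filter_le _ _)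

theorem not_exists_cardGE_iff (r : ℕ) (m : Multiset ℕ) :
    (¬ ∃ k, cardGE (k + r + 1) m = k) ↔
      ∃ k, k < cardGE (k + r + 1) m ∧ cardGE (k + r + 2) m ≤ k := by
  constructor
  · intro h
    have hex : ∃ k, cardGE (k + r + 1) m ≤ k := ⟨Multiset.card m, cardGE_le_card _ _⟩
    obtain ⟨hk, hmin⟩ := (Nat.find_eq_iff hex).1 rfl
    generalize Nat.find hex = k at hk hmin
    have hne : cardGE (k + r + 1) m ≠ k := fun e => h ⟨k, e⟩
    obtain ⟨j, rfl⟩ : ∃ j, k = j + 1 := ⟨k - 1, by omega⟩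
    refine ⟨j, not_le.1 (hmin j (by omega)), ?_⟩
    rw [show j + r + 2 = j + 1 + r + 1 by omega]
    omega
  · rintro ⟨k, h1, h2⟩ ⟨j, hj⟩
    rcases le_or_gt j k with h | h
    · have := cardGE_anti m (show j + r + 1 ≤ k + r + 1 by omega)
      omega
    · have := cardGE_anti m (show k + r + 2 ≤ j + r + 1 by omega)
      omega

theorem cardGE_crossing_unique {r : ℕ} {m : Multiset ℕ} {j k : ℕ}
    (hj : j < cardGE (j + r + 1) m ∧ cardGE (j + r + 2) m ≤ j)
    (hk : k < cardGE (k + r + 1) m ∧ cardGE (k + r + 2) m ≤ k) : j = k := by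
  rcases lt_trichotomy j k with h | h | h
  · have := cardGE_anti m (show j + r + 2 ≤ k + r + 1 by omega)
    omega
  · exact h
  · have := cardGE_anti m (show k + r + 2 ≤ j + r + 1 by omega)
    omega

/-- The `k` largest elements of a multiset are determined by it. -/
theorem Multiset.add_split_unique {t : ℕ} {a b c d : Multiset ℕ} (h : a + b = c + d)
    (hcard : card a = card c) (ha : ∀ x ∈ a, t ≤ x) (hb : ∀ x ∈ b, x ≤ t)
    (hc : ∀ x ∈ c, t ≤ x) (hd : ∀ x ∈ d, x ≤ t) : a = c ∧ b = d := by
  have key : ∀ u v : Multiset ℕ, (∀ x ∈ u, t ≤ x) → (∀ x ∈ v, x ≤ t) →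
      u = (u + v).filter (fun x => t < x) +
        replicate (card u - card ((u + v).filter (fun x => t < x))) t := by
    intro u v hu hv
    have e : (u + v).filter (fun x => t < x) = u.filter (fun x => t < x) := by
      rw [filter_add, filter_eq_nil.2 fun x hx => not_lt.2 (hv x hx), add_zero]
    have e1 := filter_add_not (fun x => t < x) u
    have e2 : u.filter (fun x => ¬ t < x) =
        replicate (card (u.filter (fun x => ¬ t < x))) t := by
      refine eq_replicate_card.2 fun x hx => ?_
      rw [mem_filter] at hx
      have := hu x hx.1
      omega
    have e3 := congrArg card e1
    rw [card_add] at e3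
    rw [e, show card u - card (u.filter (fun x => t < x)) =
      card (u.filter (fun x => ¬ t < x)) by omega, ← e2, e1]
  have hac : a = c := by
    rw [key a b ha hb, key c d hc hd, h, hcard]
  exact ⟨hac, by rwa [hac, add_right_inj] at h⟩

/-- Insert `t` and decrease every part exceeding `t` by one. -/
def lowerAbove (t : ℕ) (m : Multiset ℕ) : Multiset ℕ :=
  t ::ₘ ((m.filter (fun x => t + 1 ≤ x)).map (fun x => x - 1) +
    m.filter (fun x => ¬ t + 1 ≤ x))

theorem lowerAbove_crossing {r k : ℕ} {m : Multiset ℕ} (h : cardGE (k + (r + 1) + 1) m = k) :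
    k < cardGE (k + r + 1) (lowerAbove (k + r + 1) m) ∧
      cardGE (k + r + 2) (lowerAbove (k + r + 1) m) ≤ k := by
  rw [lowerAbove, ← Multiset.singleton_add, cardGE_add, cardGE_add, cardGE_add, cardGE_add]
  rw [show k + (r + 1) + 1 = k + r + 1 + 1 by omega, cardGE] at h
  constructor
  · rw [cardGE_eq_card (m := {k + r + 1}) (by simp), cardGE_eq_card (m := Multiset.map _ _),
      Multiset.card_map, h, Multiset.card_singleton]
    · omega
    · intro x hx
      obtain ⟨y, hy, rfl⟩ := Multiset.mem_map.1 hx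
      have := (Multiset.mem_filter.1 hy).2
      omega
  · rw [cardGE_eq_zero (m := {k + r + 1}) (by simp), cardGE_eq_zero (m := Multiset.filter _ _)]
    · have := cardGE_le_card (k + r + 2)
        ((m.filter (fun x => k + r + 1 + 1 ≤ x)).map (fun x => x - 1))
      rw [Multiset.card_map, h] at this
      omega
    · intro x hx
      have := (Multiset.mem_filter.1 hx).2
      omega

theorem sum_lowerAbove (t : ℕ) (m : Multiset ℕ) :
    (lowerAbove t m).sum + cardGE (t + 1) m = m.sum + t := by
  have h : ∀ s : Multiset ℕ, (∀ x ∈ s, 1 ≤ x) →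
      (s.map (fun x => x - 1)).sum + Multiset.card s = s.sum := by
    intro s
    induction s using Multiset.induction_on with
    | empty => simp
    | cons a s ih =>
      intro hs
      have h1 := ih fun x hx => hs x (Multiset.mem_cons_of_mem hx)
      have h2 := hs a (Multiset.mem_cons_self _ _)
      simp only [Multiset.map_cons, Multiset.sum_cons, Multiset.card_cons]
      omega
  have h1 := h (m.filter (fun x => t + 1 ≤ x)) fun x hx => by
    have := (Multiset.mem_filter.1 hx).2
    omega
  have h2 := congrArg Multiset.sum (Multiset.filter_add_not (fun x => t + 1 ≤ x) m)
  rw [Multiset.sum_add] at h2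
  rw [lowerAbove, cardGE, Multiset.sum_cons, Multiset.sum_add]
  omega

theorem isPartition_lowerAbove {t : ℕ} (ht : 0 < t) {m : Multiset ℕ} (hm : IsPartition m) :
    IsPartition (lowerAbove t m) := by
  intro x hx
  rw [lowerAbove, Multiset.mem_cons, Multiset.mem_add, Multiset.mem_map] at hx
  rcases hx with rfl | ⟨y, hy, rfl⟩ | hx
  · exact ht
  · have := (Multiset.mem_filter.1 hy).2
    omega
  · exact hm x (Multiset.mem_filter.1 hx).1

theorem lowerAbove_inj {t : ℕ} {a b : Multiset ℕ} (hc : cardGE (t + 1) a = cardGE (t + 1) b)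
    (h : lowerAbove t a = lowerAbove t b) : a = b := by
  rw [lowerAbove, lowerAbove, Multiset.cons_inj_right] at h
  have hge : ∀ m : Multiset ℕ,
      ∀ x ∈ (m.filter (fun x => t + 1 ≤ x)).map (fun x => x - 1), t ≤ x := by
    intro m x hx
    obtain ⟨y, hy, rfl⟩ := Multiset.mem_map.1 hx
    have := (Multiset.mem_filter.1 hy).2
    omega
  have hle : ∀ m : Multiset ℕ, ∀ x ∈ m.filter (fun x => ¬ t + 1 ≤ x), x ≤ t := by
    intro m x hx
    have := (Multiset.mem_filter.1 hx).2
    omega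
  have hup : ∀ m : Multiset ℕ, ((m.filter (fun x => t + 1 ≤ x)).map (fun x => x - 1)).map
      (fun x => x + 1) = m.filter (fun x => t + 1 ≤ x) := by
    intro m
    rw [Multiset.map_map]
    conv_rhs => rw [← Multiset.map_id (m.filter (fun x => t + 1 ≤ x))]
    refine Multiset.map_congr rfl fun x hx => ?_
    have := (Multiset.mem_filter.1 hx).2
    simp only [Function.comp_apply, id]
    omega
  obtain ⟨h1, h2⟩ := Multiset.add_split_unique h (by simpa [cardGE] using hc)
    (hge a) (hle a) (hge b) (hle b)
  have h3 := congrArg (Multiset.map (fun x => x + 1)) h1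
  rw [hup, hup] at h3
  rw [← Multiset.filter_add_not (fun x => t + 1 ≤ x) a, h3, h2, Multiset.filter_add_not]

theorem exists_lowerAbove_eq {t k : ℕ} {m : Multiset ℕ} (hm : IsPartition m)
    (h1 : k < cardGE t m) (h2 : cardGE (t + 1) m ≤ k) :
    ∃ m', IsPartition m' ∧ cardGE (t + 1) m' = k ∧ lowerAbove t m' = m := by
  have hcount : cardGE t m = m.count t + cardGE (t + 1) m := by
    rw [cardGE, cardGE, Multiset.count, Multiset.countP_eq_card_filter, ← Multiset.card_add,
      Multiset.filter_add_filter]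
    have e1 : m.filter (fun x => t = x ∧ t + 1 ≤ x) = 0 :=
      Multiset.filter_eq_nil.2 fun x _ => by omega
    rw [e1, add_zero]
    congr 1
    exact Multiset.filter_congr fun x _ => by omega
  set hi := m.filter (fun x => t + 1 ≤ x) with hhi
  set lo := m.filter (fun x => x < t) with hlo
  have hhic : Multiset.card hi = cardGE (t + 1) m := rfl
  set A := hi + Multiset.replicate (k - Multiset.card hi) t with hA
  set B := lo + Multiset.replicate (cardGE t m - 1 - k) t with hB
  have hmAB : m = t ::ₘ (A + B) := by
    ext x
    have hrep : ∀ i, (Multiset.replicate i t).count x = if t = x then i else 0 := fun i =>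
      Multiset.count_replicate _ _ _
    rw [Multiset.count_cons, hA, hB, Multiset.count_add, Multiset.count_add, Multiset.count_add,
      hrep, hrep, hhi, hlo, Multiset.count_filter, Multiset.count_filter]
    rcases lt_trichotomy x t with h | h | h
    · simp [h, h.ne, h.ne', show ¬ t + 1 ≤ x by omega]
    · subst h
      simp only [lt_irrefl, if_true, if_false, show ¬ x + 1 ≤ x by omega]
      rw [hhi] at hhic
      omega
    · simp [h.ne, h.ne', show t + 1 ≤ x by omega, show ¬ x < t by omega]
  have hAt : ∀ x ∈ A, t ≤ x := by
    intro x hx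
    rcases Multiset.mem_add.1 hx with hx | hx
    · have := (Multiset.mem_filter.1 hx).2
      omega
    · exact (Multiset.eq_of_mem_replicate hx).ge
  have hBt : ∀ x ∈ B, ¬ t + 1 ≤ x := by
    intro x hx
    rcases Multiset.mem_add.1 hx with hx | hx
    · have := (Multiset.mem_filter.1 hx).2
      omega
    · have := Multiset.eq_of_mem_replicate hx
      omega
  have hAc : Multiset.card A = k := by
    rw [hA, Multiset.card_add, Multiset.card_replicate]
    omega
  have hup : ∀ x ∈ A.map (fun x => x + 1), t + 1 ≤ x := by
    intro x hx
    obtain ⟨y, hy, rfl⟩ := Multiset.mem_map.1 hx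
    have := hAt y hy
    omega
  clear_value A B
  refine ⟨A.map (fun x => x + 1) + B, ?_, ?_, ?_⟩
  · intro x hx
    rcases Multiset.mem_add.1 hx with hx | hx
    · have := hup x hx
      omega
    · refine hm x ?_
      rw [hmAB]
      exact Multiset.mem_cons_of_mem (Multiset.mem_add.2 (Or.inr hx))
  · rw [cardGE_add, cardGE_eq_card hup, cardGE_eq_zero fun x hx => not_le.1 (hBt x hx),
      Multiset.card_map, hAc, add_zero]
  · rw [lowerAbove, Multiset.filter_add, Multiset.filter_add, Multiset.filter_eq_self.2 hup,
      Multiset.filter_eq_nil.2 hBt, Multiset.filter_eq_self.2 hBt,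
      Multiset.filter_eq_nil.2 fun x hx => not_not.2 (hup x hx), add_zero, zero_add,
      Multiset.map_map]
    conv_rhs => rw [hmAB]
    simp

theorem ncard_durfee_recursion (r n : ℕ) :
    {p : Multiset ℕ × Multiset ℕ |
      ((IsPartition p.1 ∧ IsPartition p.2) ∧ ∃ k, cardGE (k + (r + 1) + 1) p.2 = k) ∧
        p.1.sum + p.2.sum + (r + 1) = n}.ncard =
    {p : Multiset ℕ × Multiset ℕ | ((IsPartition p.1 ∧ IsPartition p.2) ∧
      ¬ ((IsPartition p.1 ∧ IsPartition p.2) ∧ ∃ k, cardGE (k + r + 1) p.2 = k)) ∧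
        p.1.sum + p.2.sum = n}.ncard := by
  refine Set.ncard_congr
    (fun p hp => (p.1, lowerAbove (hp.1.2.choose + r + 1) p.2)) ?_ ?_ ?_
  · rintro ⟨a, b⟩ hp
    have hk := hp.1.2.choose_spec
    generalize hp.1.2.choose = k at hk ⊢
    obtain ⟨⟨⟨ha, hb⟩, -⟩, hs⟩ := hp
    dsimp only at ha hb hs hk ⊢
    refine ⟨⟨⟨ha, isPartition_lowerAbove (by omega) hb⟩, fun h => ?_⟩, ?_⟩
    · exact (not_exists_cardGE_iff _ _).2 ⟨k, lowerAbove_crossing hk⟩ h.2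
    · have := sum_lowerAbove (k + r + 1) b
      rw [show k + r + 1 + 1 = k + (r + 1) + 1 by omega, hk] at this
      dsimp only
      omega
  · rintro ⟨a, b⟩ ⟨c, d⟩ hp hq he
    have hk := hp.1.2.choose_spec
    have hj := hq.1.2.choose_spec
    dsimp only at he
    generalize hp.1.2.choose = k at hk he
    generalize hq.1.2.choose = j at hj he
    dsimp only at hk hj
    rw [Prod.mk.injEq] at he
    obtain ⟨rfl, he⟩ := he
    have hkj : k = j := by
      refine cardGE_crossing_unique (lowerAbove_crossing hk) ?_
      rw [he]
      exact lowerAbove_crossing hj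
    subst hkj
    rw [show k + (r + 1) + 1 = k + r + 1 + 1 by omega] at hk hj
    rw [lowerAbove_inj (hk.trans hj.symm) he]
  · rintro ⟨a, b⟩ ⟨⟨⟨ha, hb⟩, h⟩, hs⟩
    dsimp only at ha hb h hs
    obtain ⟨k, h1, h2⟩ := (not_exists_cardGE_iff r b).1 fun h' => h ⟨⟨ha, hb⟩, h'⟩
    obtain ⟨m, hm, hmk, rfl⟩ := exists_lowerAbove_eq hb h1 h2
    have hsum := sum_lowerAbove (k + r + 1) m
    have hmk' : cardGE (k + (r + 1) + 1) m = k := by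
      rwa [show k + (r + 1) + 1 = k + r + 1 + 1 by omega]
    have hp : (a, m) ∈ {p : Multiset ℕ × Multiset ℕ |
        ((IsPartition p.1 ∧ IsPartition p.2) ∧ ∃ k, cardGE (k + (r + 1) + 1) p.2 = k) ∧
          p.1.sum + p.2.sum + (r + 1) = n} := by
      refine ⟨⟨⟨ha, hm⟩, k, hmk'⟩, ?_⟩
      dsimp only
      omega
    refine ⟨(a, m), hp, ?_⟩
    have hj := hp.1.2.choose_spec
    dsimp only
    generalize hp.1.2.choose = j at hj ⊢
    have hjk : j = k := by
      have hj' := hj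
      dsimp only at hj'
      rcases le_total j k with h | h
      · have := cardGE_anti m (show j + (r + 1) + 1 ≤ k + (r + 1) + 1 by omega)
        omega
      · have := cardGE_anti m (show k + (r + 1) + 1 ≤ j + (r + 1) + 1 by omega)
        omega
    rw [hjk]

/-- Combinatorial content of Lemma 1: for all nonnegative integers `r` and `n`, the number of
pairs `(λ, π)` of partitions with `λ` of largest part exactly `k` and all parts of `π` at most
`k + r` for some `k`, with `|λ| + |π| = n`, equals the number of pairs `(μ, ν)` with `μ`
arbitrary and `ν ∈ Q_{k,r}` for some `k`, with `|μ| + |ν| = n`. -/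
theorem stmt0 (r n : ℕ) :
    {p : Multiset ℕ × Multiset ℕ |
      IsPartition p.1 ∧ IsPartition p.2 ∧
      (∃ k : ℕ, p.1.sup = k ∧ ∀ x ∈ p.2, x ≤ k + r) ∧
      p.1.sum + p.2.sum = n}.ncard =
    {p : Multiset ℕ × Multiset ℕ |
      IsPartition p.1 ∧ (∃ k : ℕ, QSet k r p.2) ∧
      p.1.sum + p.2.sum = n}.ncard := by
  have main := ncard_eq_of_complement_recursion
    (fun p : Multiset ℕ × Multiset ℕ => p.1.sum + p.2.sum)
    {p | IsPartition p.1 ∧ IsPartition p.2} finite_partition_pairs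
    (fun r => {p | (IsPartition p.1 ∧ IsPartition p.2) ∧ p.2.sup ≤ p.1.sup + r})
    (fun r => {p | (IsPartition p.1 ∧ IsPartition p.2) ∧ ∃ k, cardGE (k + r + 1) p.2 = k})
    (fun _ _ h => h.1) (fun _ _ h => h.1) ncard_sup_recursion ncard_durfee_recursion r n
  convert main using 2
  · ext p
    simp only [Set.mem_ofPred_eq, exists_eq_left', Multiset.sup_le]
    tauto
  · ext p
    simp only [Set.mem_ofPred_eq, QSet, cardGE, exists_and_left]
    tauto
end

section
/- For all nonnegative integers k, r, and n, the number of pairs (μ*, ν*) with μ* ∈ E*, ν* ∈ EO*_{k,r}, and |μ*| + |ν*| = n equals the number of pairs (μ, ν) with μ an arbitrary partition, ν ∈ Q_{k,r}, and 4|μ| + 4|ν| + 2r = n. -/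
/-- A multiset all of whose multiplicities are even is twice another multiset. -/
lemma exists_eq_two_nsmul_of_even_count {α : Type*} [DecidableEq α] (m : Multiset α)
    (h : ∀ x, Even (m.count x)) : ∃ a : Multiset α, m = 2 • a := by
  refine ⟨∑ x ∈ m.toFinset, (m.count x / 2) • {x}, ?_⟩
  rw [Finset.smul_sum]
  conv_lhs => rw [← Multiset.toFinset_sum_count_nsmul_eq m]
  refine Finset.sum_congr rfl fun x _ => ?_
  rw [← mul_nsmul', Nat.mul_div_cancel' (h x).two_dvd]

lemma two_nsmul_multiset_injective {α : Type*} :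
    Function.Injective fun a : Multiset α => 2 • a := by
  classical
  intro a b h
  ext x
  have := congrArg (Multiset.count x) h
  simpa [Multiset.count_nsmul] using this

lemma mem_two_nsmul {α : Type*} {a : Multiset α} {x : α} : x ∈ 2 • a ↔ x ∈ a := by
  simp [two_nsmul]

/-- Send parts `x > c` to the odd number `2x - 1` and parts `x ≤ c` to the even number `2x`. -/
def splitDouble (c x : ℕ) : ℕ := if c + 1 ≤ x then 2 * x - 1 else 2 * x

lemma splitDouble_injective (c : ℕ) : Function.Injective (splitDouble c) := by
  intro x y h
  unfold splitDouble at h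
  split_ifs at h <;> omega

lemma odd_splitDouble_iff (c x : ℕ) : Odd (splitDouble c x) ↔ c + 1 ≤ x := by
  unfold splitDouble
  rw [Nat.odd_iff]
  split_ifs <;> omega

lemma splitDouble_half {c y : ℕ} (he : Even y → y ≤ 2 * c) (ho : Odd y → 2 * c < y) :
    splitDouble c ((y + 1) / 2) = y := by
  rw [Nat.even_iff] at he
  rw [Nat.odd_iff] at ho
  unfold splitDouble
  split_ifs <;> omega

/-- The single part `c`, or no part at all when `c = 0`. -/
def singlePart (c : ℕ) : Multiset ℕ := if c = 0 then 0 else {c}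

lemma mem_singlePart {c x : ℕ} : x ∈ singlePart c ↔ x = c ∧ c ≠ 0 := by
  unfold singlePart
  split_ifs with h <;> simp [h]

lemma sum_singlePart (c : ℕ) : (singlePart c).sum = c := by
  unfold singlePart
  split_ifs with h <;> simp [h]

lemma count_singlePart_self {c : ℕ} (h : c ≠ 0) : (singlePart c).count c = 1 := by
  simp [singlePart, h]

lemma le_lep {m : Multiset ℕ} {x : ℕ} (hx : x ∈ m) (he : Even x) : x ≤ lep m :=
  Multiset.le_sup (Multiset.mem_filter.2 ⟨hx, he⟩)

lemma lep_mem {m : Multiset ℕ} (h : lep m ≠ 0) : lep m ∈ m := by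
  have key : ∀ s : Multiset ℕ, s.sup ≠ 0 → s.sup ∈ s := by
    intro s
    induction s using Multiset.induction_on with
    | empty => simp
    | cons a s ih =>
      intro hs
      rw [Multiset.sup_cons] at hs ⊢
      rcases le_total s.sup a with h1 | h1
      · simp [h1]
      · rw [sup_eq_right.2 h1] at hs ⊢
        exact Multiset.mem_cons_of_mem (ih hs)
  exact Multiset.mem_of_mem_filter (key _ h)

/-- Double every part and its multiplicity. -/
def doubleParts (m : Multiset ℕ) : Multiset ℕ := 2 • m.map (2 * ·)

lemma doubleParts_injective : Function.Injective doubleParts :=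
  two_nsmul_multiset_injective.comp (Multiset.map_injective fun _ _ h => by simpa using h)

lemma sum_doubleParts (m : Multiset ℕ) : (doubleParts m).sum = 4 * m.sum := by
  rw [doubleParts, Multiset.sum_nsmul, Multiset.sum_map_mul_left, Multiset.map_id', smul_eq_mul,
    ← mul_assoc, show 2 * 2 = 4 from rfl]

lemma eStar_doubleParts {m : Multiset ℕ} (hm : IsPartition m) : EStar (doubleParts m) := by
  refine ⟨fun x hx => ?_, fun x hx => ?_, fun x => ?_⟩
  · obtain ⟨y, hy, rfl⟩ := Multiset.mem_map.1 (mem_two_nsmul.1 hx)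
    have := hm y hy
    omega
  · obtain ⟨y, hy, rfl⟩ := Multiset.mem_map.1 (mem_two_nsmul.1 hx)
    exact even_two_mul y
  · simp [doubleParts, Multiset.count_nsmul]

lemma exists_doubleParts_eq {m : Multiset ℕ} (hm : EStar m) :
    ∃ a, IsPartition a ∧ doubleParts a = m := by
  obtain ⟨hpos, heven, hcount⟩ := hm
  obtain ⟨a, rfl⟩ := exists_eq_two_nsmul_of_even_count m hcount
  refine ⟨a.map (· / 2), fun x hx => ?_, ?_⟩
  · obtain ⟨y, hy, rfl⟩ := Multiset.mem_map.1 hx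
    have h1 := hpos y (mem_two_nsmul.2 hy)
    have h2 := (heven y (mem_two_nsmul.2 hy)).two_dvd
    omega
  · rw [doubleParts, Multiset.map_map]
    congr 1
    refine (Multiset.map_congr rfl fun y hy => ?_).trans (Multiset.map_id a)
    exact Nat.mul_div_cancel' (heven y (mem_two_nsmul.2 hy)).two_dvd

/-- The partition in `EO*_{k,r}` attached to a partition in `Q_{k,r}`, where `c = k + r`. -/
def splitParts (c : ℕ) (m : Multiset ℕ) : Multiset ℕ :=
  2 • m.map (splitDouble c) + singlePart (2 * c)

lemma splitParts_injective (c : ℕ) : Function.Injective (splitParts c) := fun _ _ h =>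
  Multiset.map_injective (splitDouble_injective c)
    (two_nsmul_multiset_injective (add_right_cancel h))

lemma sum_map_splitDouble (c : ℕ) (m : Multiset ℕ) :
    (m.map (splitDouble c)).sum + (m.filter (fun x => c + 1 ≤ x)).card = 2 * m.sum := by
  induction m using Multiset.induction_on with
  | empty => simp
  | cons a s ih =>
    by_cases h : c + 1 ≤ a
    · rw [Multiset.map_cons, Multiset.sum_cons, Multiset.filter_cons_of_pos (p := (c + 1 ≤ ·)) _ h,
        Multiset.card_cons, Multiset.sum_cons, splitDouble, if_pos h]
      omega
    · rw [Multiset.map_cons, Multiset.sum_cons, Multiset.filter_cons_of_neg (p := (c + 1 ≤ ·)) _ h,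
        Multiset.sum_cons, splitDouble, if_neg h]
      omega

lemma sum_splitParts {k r : ℕ} {m : Multiset ℕ} (hm : QSet k r m) :
    (splitParts (k + r) m).sum = 4 * m.sum + 2 * r := by
  have h := sum_map_splitDouble (k + r) m
  rw [hm.2] at h
  rw [splitParts, Multiset.sum_add, Multiset.sum_nsmul, sum_singlePart, smul_eq_mul]
  omega

lemma mem_splitParts {c x : ℕ} {m : Multiset ℕ} :
    x ∈ splitParts c m ↔ (∃ y ∈ m, splitDouble c y = x) ∨ (x = 2 * c ∧ 2 * c ≠ 0) := by
  rw [splitParts, Multiset.mem_add, mem_two_nsmul, Multiset.mem_map, mem_singlePart]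

lemma card_filter_odd_splitParts (c : ℕ) (m : Multiset ℕ) :
    ((splitParts c m).filter (fun x => Odd x)).card =
      2 * (m.filter (fun x => c + 1 ≤ x)).card := by
  have h : (singlePart (2 * c)).filter (fun x => Odd x) = 0 := by
    refine Multiset.filter_eq_nil.2 fun x hx => ?_
    rw [(mem_singlePart.1 hx).1]
    simp
  rw [splitParts, Multiset.filter_add, h, add_zero, Multiset.filter_nsmul, Multiset.card_nsmul,
    Multiset.filter_map, Multiset.card_map]
  simp only [Function.comp_def, odd_splitDouble_iff]

lemma even_le_of_mem_splitParts {c x : ℕ} {m : Multiset ℕ} (hx : x ∈ splitParts c m)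
    (he : Even x) : x ≤ 2 * c := by
  rcases mem_splitParts.1 hx with ⟨y, -, rfl⟩ | h
  · have := (odd_splitDouble_iff c y).not.1 (Nat.not_odd_iff_even.2 he)
    unfold splitDouble
    split_ifs
    omega
  · exact h.1.le

lemma lt_odd_of_mem_splitParts {c x : ℕ} {m : Multiset ℕ} (hx : x ∈ splitParts c m)
    (ho : Odd x) : 2 * c < x := by
  rcases mem_splitParts.1 hx with ⟨y, -, rfl⟩ | h
  · have := (odd_splitDouble_iff c y).1 ho
    unfold splitDouble
    split_ifs
    omega
  · rw [h.1] at ho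
    exact absurd ho (by simp)

lemma lep_splitParts (c : ℕ) (m : Multiset ℕ) : lep (splitParts c m) = 2 * c := by
  refine le_antisymm (Multiset.sup_le.2 fun x hx => ?_) ?_
  · rw [Multiset.mem_filter] at hx
    exact even_le_of_mem_splitParts hx.1 hx.2
  · rcases eq_or_ne (2 * c) 0 with h | h
    · omega
    · exact le_lep (mem_splitParts.2 (Or.inr ⟨rfl, h⟩)) (even_two_mul c)

lemma eOkr_splitParts {k r : ℕ} {m : Multiset ℕ} (hm : QSet k r m) :
    EOkr k r (splitParts (k + r) m) := by
  have hpos : IsPartition (splitParts (k + r) m) := by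
    intro x hx
    rcases mem_splitParts.1 hx with ⟨y, hy, rfl⟩ | h
    · have := hm.1 y hy
      unfold splitDouble
      split_ifs <;> omega
    · omega
  refine ⟨⟨hpos, fun x hx y hy he ho => ?_, fun x _ hne => ?_, fun x hx heq => ?_⟩, ?_, ?_⟩
  · exact (even_le_of_mem_splitParts hx he).trans_lt (lt_odd_of_mem_splitParts hy ho)
  · rw [lep_splitParts] at hne
    rw [splitParts, Multiset.count_add, Multiset.count_nsmul,
      Multiset.count_eq_zero_of_notMem fun h => hne (mem_singlePart.1 h).1]
    simp
  · rw [lep_splitParts] at heq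
    subst heq
    rw [splitParts, Multiset.count_add, Multiset.count_nsmul,
      count_singlePart_self (hpos _ hx).ne']
    simp
  · rw [card_filter_odd_splitParts, hm.2]
  · rw [lep_splitParts]
    ring

lemma exists_splitParts_eq {k r : ℕ} {m : Multiset ℕ} (hm : EOkr k r m) :
    ∃ a, QSet k r a ∧ splitParts (k + r) a = m := by
  obtain ⟨⟨hpos, hlt, hne, heq⟩, hcard, hlep⟩ := hm
  rw [← mul_add] at hlep
  have hmem : 2 * (k + r) ≠ 0 → 2 * (k + r) ∈ m := fun h => hlep ▸ lep_mem (hlep ▸ h)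
  have hle : singlePart (2 * (k + r)) ≤ m := by
    unfold singlePart
    split_ifs with h
    · exact zero_le
    · exact Multiset.singleton_le.2 (hmem h)
  obtain ⟨m', rfl⟩ := Multiset.le_iff_exists_add.1 hle
  have hcount : ∀ x, Even (m'.count x) := by
    intro x
    by_cases hx : x ∈ m'
    · have hx' := Multiset.mem_add.2 (Or.inr hx : x ∈ singlePart (2 * (k + r)) ∨ x ∈ m')
      by_cases hxl : x = 2 * (k + r)
      · have h := heq x hx' (hxl.trans hlep.symm)
        have h0 := (hpos x hx').ne'
        subst hxl
        rw [Multiset.count_add, count_singlePart_self h0] at h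
        rw [Nat.odd_iff] at h
        rw [Nat.even_iff]
        omega
      · have h := hne x hx' fun h => hxl (h.trans hlep)
        rwa [Multiset.count_add,
          Multiset.count_eq_zero_of_notMem fun h => hxl (mem_singlePart.1 h).1, zero_add] at h
    · simp [Multiset.count_eq_zero_of_notMem hx]
  obtain ⟨b, rfl⟩ := exists_eq_two_nsmul_of_even_count m' hcount
  have hb : ∀ y ∈ b, y ∈ singlePart (2 * (k + r)) + 2 • b := fun y hy =>
    Multiset.mem_add.2 (Or.inr (mem_two_nsmul.2 hy))
  have hhalf : ∀ y ∈ b, splitDouble (k + r) ((y + 1) / 2) = y := by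
    refine fun y hy => splitDouble_half (fun he => hlep ▸ le_lep (hb y hy) he) fun ho => ?_
    rcases eq_or_ne (2 * (k + r)) 0 with h | h
    · rw [h]
      exact ho.pos
    · exact hlt _ (hmem h) y (hb y hy) (even_two_mul _) ho
  have hsplit : splitParts (k + r) (b.map fun y => (y + 1) / 2) =
      singlePart (2 * (k + r)) + 2 • b := by
    rw [splitParts, Multiset.map_map, add_comm]
    congr 2
    exact (Multiset.map_congr rfl hhalf).trans (Multiset.map_id b)
  refine ⟨b.map fun y => (y + 1) / 2, ⟨fun x hx => ?_, ?_⟩, hsplit⟩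
  · obtain ⟨y, hy, rfl⟩ := Multiset.mem_map.1 hx
    have := hpos y (hb y hy)
    omega
  · rw [← hsplit, card_filter_odd_splitParts] at hcard
    omega

/-- Lemma 3: for all nonnegative integers `k`, `r`, `n`, the number of pairs
`(μ*, ν*) ∈ E* × EO*_{k,r}` with `|μ*| + |ν*| = n` equals the number of pairs
`(μ, ν) ∈ P × Q_{k,r}` with `4|μ| + 4|ν| + 2r = n`. -/
theorem stmt2 (k r n : ℕ) :
    {p : Multiset ℕ × Multiset ℕ |
      EStar p.1 ∧ EOkr k r p.2 ∧ p.1.sum + p.2.sum = n}.ncard =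
    {p : Multiset ℕ × Multiset ℕ |
      IsPartition p.1 ∧ QSet k r p.2 ∧
      4 * p.1.sum + 4 * p.2.sum + 2 * r = n}.ncard := by
  let F : Multiset ℕ × Multiset ℕ → Multiset ℕ × Multiset ℕ :=
    Prod.map doubleParts (splitParts (k + r))
  have hF : Function.Injective F := doubleParts_injective.prodMap (splitParts_injective (k + r))
  refine Eq.trans (congrArg Set.ncard ?_) (Set.ncard_image_of_injective _ hF)
  ext ⟨a, b⟩
  constructor
  · rintro ⟨ha, hb, hn⟩
    obtain ⟨μ, hμ, rfl⟩ := exists_doubleParts_eq ha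
    obtain ⟨ν, hν, rfl⟩ := exists_splitParts_eq hb
    refine ⟨(μ, ν), ⟨hμ, hν, ?_⟩, rfl⟩
    change 4 * μ.sum + 4 * ν.sum + 2 * r = n
    dsimp only at hn
    rw [sum_doubleParts, sum_splitParts hν] at hn
    omega
  · rintro ⟨⟨μ, ν⟩, ⟨hμ, hν, hn⟩, heq⟩
    obtain ⟨rfl, rfl⟩ := Prod.mk.inj heq
    refine ⟨eStar_doubleParts hμ, eOkr_splitParts hν, ?_⟩
    change (doubleParts μ).sum + (splitParts (k + r) ν).sum = n
    change 4 * μ.sum + 4 * ν.sum + 2 * r = n at hn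
    rw [sum_doubleParts, sum_splitParts (m := ν) hν]
    omega
end
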